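/- arXiv:2601.10375 — 2 statements merged into one kernel-verified Lean document; each statement's English description precedes it below -/
import Mathlib

section
/- Let μ and ν be Borel probability measures on ℝ with finite second moments and quantile functions Q_μ and Q_ν. Then there exists a nondecreasing 1-Lipschitz function F : ℝ → ℝ with F_# μ = ν if and only if 0 ≤ Q_ν(x) − Q_ν(y) ≤ Q_μ(x) − Q_μ(y) for all 0 < y < x < 1. -/
open MeasureTheory

/-- The CDF of a Borel measure on `ℝ`, as a real-valued function. -/
noncomputable def cdf (μ : Measure ℝ) (x : ℝ) : ℝ := (μ (Set.Iic x)).toReal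

/-- The quantile function `Q_μ(u) = inf {x | F_μ(x) ≥ u}` (generalized inverse of the CDF). -/
noncomputable def quantile (μ : Measure ℝ) (u : ℝ) : ℝ := sInf {x : ℝ | u ≤ cdf μ x}

theorem cdf_eq_probabilityTheory_cdf (μ : Measure ℝ) [IsProbabilityMeasure μ] (x : ℝ) :
    cdf μ x = ProbabilityTheory.cdf μ x :=
  (ProbabilityTheory.cdf_eq_real μ x).symm

theorem cdf_le_cdf_of_le (μ : Measure ℝ) [IsProbabilityMeasure μ] {x y : ℝ} (h : x ≤ y) :
    cdf μ x ≤ cdf μ y := by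
  simpa only [cdf_eq_probabilityTheory_cdf] using ProbabilityTheory.monotone_cdf μ h

/-- The quantile function is the lower adjoint of the CDF. -/
theorem quantile_le_iff (μ : Measure ℝ) [IsProbabilityMeasure μ] {u : ℝ} (h0 : 0 < u)
    (h1 : u < 1) (x : ℝ) : quantile μ u ≤ x ↔ u ≤ cdf μ x := by
  have hbdd : BddBelow {x : ℝ | u ≤ cdf μ x} := by
    obtain ⟨b, hb⟩ := ((ProbabilityTheory.tendsto_cdf_atBot μ).eventually (gt_mem_nhds h0)).exists
    refine ⟨b, fun y hy => le_of_not_gt fun hyb => ?_⟩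
    have hle := cdf_le_cdf_of_le μ hyb.le
    rw [cdf_eq_probabilityTheory_cdf μ b] at hle
    exact absurd (hy.trans hle) (not_le.2 hb)
  have hne : {x : ℝ | u ≤ cdf μ x}.Nonempty := by
    obtain ⟨b, hb⟩ := ((ProbabilityTheory.tendsto_cdf_atTop μ).eventually (lt_mem_nhds h1)).exists
    exact ⟨b, hb.le.trans_eq (cdf_eq_probabilityTheory_cdf μ b).symm⟩
  refine ⟨fun h => ?_, fun h => csInf_le hbdd h⟩
  have hright : Filter.Tendsto (cdf μ) (nhdsWithin x (Set.Ioi x)) (nhds (cdf μ x)) := by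
    have hc := ((ProbabilityTheory.cdf μ).right_continuous x).mono Set.Ioi_subset_Ici_self
    rwa [← funext (cdf_eq_probabilityTheory_cdf μ)] at hc
  refine ge_of_tendsto hright (eventually_nhdsWithin_of_forall fun y hy => ?_)
  obtain ⟨z, hz, hzy⟩ := exists_lt_of_csInf_lt hne (lt_of_le_of_lt h hy)
  exact le_trans hz (cdf_le_cdf_of_le μ hzy.le)

theorem quantile_le_quantile (μ : Measure ℝ) [IsProbabilityMeasure μ] {u v : ℝ} (hu : 0 < u)
    (huv : u ≤ v) (hv : v < 1) : quantile μ u ≤ quantile μ v :=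
  (quantile_le_iff μ hu (huv.trans_lt hv) _).2
    (huv.trans ((quantile_le_iff μ (hu.trans_le huv) hv _).1 le_rfl))

theorem quantile_map (μ : Measure ℝ) [IsProbabilityMeasure μ] {F : ℝ → ℝ} (hF : Monotone F)
    (hc : Continuous F) {u : ℝ} (h0 : 0 < u) (h1 : u < 1) :
    quantile (μ.map F) u = F (quantile μ u) := by
  have : IsProbabilityMeasure (μ.map F) :=
    Measure.isProbabilityMeasure_map hc.measurable.aemeasurable
  refine eq_of_forall_ge_iff fun z => ?_
  have hmap : cdf (μ.map F) z = (μ (F ⁻¹' Set.Iic z)).toReal := by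
    rw [cdf, Measure.map_apply hc.measurable measurableSet_Iic]
  rw [quantile_le_iff _ h0 h1, hmap]
  constructor
  · intro h
    by_contra! hz
    obtain ⟨w, hw, hwz⟩ := (hc.continuousAt.eventually (lt_mem_nhds hz)).exists_lt
    refine absurd ((quantile_le_iff μ h0 h1 w).2 (h.trans ?_)) (not_le.2 hw)
    refine ENNReal.toReal_mono (measure_ne_top _ _) (measure_mono fun y hy => ?_)
    exact le_of_not_gt fun hwy => absurd (hwz.trans_le (hF hwy.le)) (not_lt.2 hy)
  · intro h
    refine ((quantile_le_iff μ h0 h1 _).1 le_rfl).trans ?_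
    exact ENNReal.toReal_mono (measure_ne_top _ _) (measure_mono fun y hy => (hF hy).trans h)

theorem eq_of_quantile_eq (μ ν : Measure ℝ) [IsProbabilityMeasure μ] [IsProbabilityMeasure ν]
    (h : ∀ u, 0 < u → u < 1 → quantile μ u = quantile ν u) : μ = ν := by
  have key : ∀ (a b : Measure ℝ) [IsProbabilityMeasure a] [IsProbabilityMeasure b],
      (∀ u, 0 < u → u < 1 → quantile a u = quantile b u) → ∀ x, cdf a x ≤ cdf b x := by
    intro a b _ _ hab x
    by_contra! hlt
    obtain ⟨u, hbu, hua⟩ := exists_between hlt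
    have h0 : 0 < u := lt_of_le_of_lt ENNReal.toReal_nonneg hbu
    have h1 : u < 1 := hua.trans_le (by
      rw [cdf_eq_probabilityTheory_cdf]; exact ProbabilityTheory.cdf_le_one a x)
    refine absurd ((quantile_le_iff b h0 h1 x).1 ?_) (not_le.2 hbu)
    rw [← hab u h0 h1]
    exact (quantile_le_iff a h0 h1 x).2 hua.le
  refine Measure.eq_of_cdf μ ν (StieltjesFunction.ext fun x => ?_)
  simpa only [cdf_eq_probabilityTheory_cdf] using
    le_antisymm (key μ ν h x) (key ν μ (fun u h0 h1 => (h u h0 h1).symm) x)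

/-- If the increments of `q` are nonnegative and dominated by those of `p`, then `q` factors
through `p` via a nondecreasing `1`-Lipschitz function. -/
theorem exists_monotone_lipschitz_comp_eq {ι : Type*} [LinearOrder ι] [Nonempty ι] (p q : ι → ℝ)
    (h : ∀ v u, v < u → 0 ≤ q u - q v ∧ q u - q v ≤ p u - p v) :
    ∃ F : ℝ → ℝ, Monotone F ∧ LipschitzWith 1 F ∧ ∀ u, F (p u) = q u := by
  have hbdd : ∀ x, BddAbove (Set.range fun u => q u - max (p u - x) 0) := by
    intro x
    obtain ⟨w⟩ := ‹Nonempty ι›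
    refine ⟨max (q w) (q w - p w + x), ?_⟩
    rintro _ ⟨u, rfl⟩
    have hl := le_max_left (p u - x) 0
    have hr := le_max_right (p u - x) 0
    rcases lt_trichotomy u w with hu | rfl | hu
    · exact le_max_of_le_left (by linarith [(h u w hu).1])
    · exact le_max_of_le_left (by linarith)
    · exact le_max_of_le_right (by linarith [(h w u hu).2])
  refine ⟨fun x => ⨆ u, (q u - max (p u - x) 0), fun x y hxy => ?_, ?_, fun u => ?_⟩
  · refine ciSup_mono (hbdd y) fun u => ?_
    gcongr
  · refine LipschitzWith.of_le_add fun x y => ciSup_le fun u => ?_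
    have hu := le_ciSup (hbdd y) u
    have hd : x - y ≤ dist x y := le_abs_self _
    have hm : max (p u - y) 0 ≤ max (p u - x) 0 + dist x y :=
      max_le (by linarith [le_max_left (p u - x) 0])
        (by linarith [le_max_right (p u - x) 0, dist_nonneg (x := x) (y := y)])
    linarith
  · refine le_antisymm (ciSup_le fun v => ?_) ?_
    · have hl := le_max_left (p v - p u) 0
      have hr := le_max_right (p v - p u) 0
      rcases lt_trichotomy v u with hv | rfl | hv
      · linarith [(h v u hv).1]
      · linarith
      · linarith [(h u v hv).2]
    · simpa using le_ciSup (hbdd (p u)) u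

/-- quantile-domination characterization: there exists a nondecreasing
1-Lipschitz map `F` with `F_# μ = ν` if and only if
`0 ≤ Q_ν(x) − Q_ν(y) ≤ Q_μ(x) − Q_μ(y)` for all `0 < y < x < 1`. -/
theorem exists_monotone_lipschitz_pushforward_iff
    (μ ν : Measure ℝ) [IsProbabilityMeasure μ] [IsProbabilityMeasure ν]
    (hμ2 : Integrable (fun x : ℝ => x ^ 2) μ) (hν2 : Integrable (fun x : ℝ => x ^ 2) ν) :
    (∃ F : ℝ → ℝ, Monotone F ∧ LipschitzWith 1 F ∧ Measure.map F μ = ν) ↔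
      (∀ y x : ℝ, 0 < y → y < x → x < 1 →
        0 ≤ quantile ν x - quantile ν y ∧
          quantile ν x - quantile ν y ≤ quantile μ x - quantile μ y) := by
  constructor
  · rintro ⟨F, hF, hL, rfl⟩ y x hy hyx hx
    rw [quantile_map μ hF hL.continuous (hy.trans hyx) hx,
      quantile_map μ hF hL.continuous hy (hyx.trans hx)]
    have hq := quantile_le_quantile μ hy hyx.le hx
    refine ⟨sub_nonneg.2 (hF hq), ?_⟩
    have hd := hL.dist_le_mul (quantile μ x) (quantile μ y)
    rw [Real.dist_eq, Real.dist_eq, abs_of_nonneg (sub_nonneg.2 hq), NNReal.coe_one, one_mul] at hd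
    exact (le_abs_self _).trans hd
  · intro h
    have : Nonempty (Set.Ioo (0 : ℝ) 1) := ⟨⟨1 / 2, by norm_num, by norm_num⟩⟩
    obtain ⟨F, hF, hL, hFq⟩ := exists_monotone_lipschitz_comp_eq
      (fun u : Set.Ioo (0 : ℝ) 1 => quantile μ u) (fun u => quantile ν u)
      fun v u hvu => h v u v.2.1 hvu u.2.2
    have : IsProbabilityMeasure (μ.map F) :=
      Measure.isProbabilityMeasure_map hL.continuous.measurable.aemeasurable
    refine ⟨F, hF, hL, eq_of_quantile_eq _ _ fun u h0 h1 => ?_⟩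
    rw [quantile_map μ hF hL.continuous h0 h1]
    exact hFq ⟨u, h0, h1⟩
end

section
/- Let μ be a Borel probability measure on ℝ with finite first moment, quantile function Q, and median m := Q(1/2). Then (i) ∫₀^{1/2} (Q(1−u) + Q(u) − 2m) du = ∫_ℝ x μ(dx) − m, and (ii) ∫₀^{1/2} (Q(1−u) − Q(u)) du = ∫_ℝ |x − m| μ(dx). Consequently, the integrated quantile skewness measure Skew_int := [∫₀^{1/2}(Q(1−u)+Q(u)−2m)du] / [∫₀^{1/2}(Q(1−u)−Q(u))du] equals (mean(μ) − m) / ∫|x − m| μ(dx), whenever the denominator is nonzero. -/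
open MeasureTheory

open Set

lemma le_cdf_iff_quantile_le (μ : Measure ℝ) [IsProbabilityMeasure μ] {u : ℝ}
    (hu : u ∈ Ioo (0 : ℝ) 1) (x : ℝ) : u ≤ cdf μ x ↔ quantile μ u ≤ x := by
  have hcdf : ∀ y, cdf μ y = ProbabilityTheory.cdf μ y := fun y =>
    (ProbabilityTheory.cdf_eq_real μ y).symm
  have hmono : Monotone (cdf μ) := fun a b hab => by
    rw [hcdf, hcdf]; exact ProbabilityTheory.monotone_cdf μ hab
  obtain ⟨b, hb⟩ :=
    ((ProbabilityTheory.tendsto_cdf_atBot μ).eventually (gt_mem_nhds hu.1)).exists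
  obtain ⟨t, ht⟩ :=
    ((ProbabilityTheory.tendsto_cdf_atTop μ).eventually (lt_mem_nhds hu.2)).exists
  have hbdd : BddBelow {y : ℝ | u ≤ cdf μ y} := by
    refine ⟨b, fun y hy => ?_⟩
    by_contra! hlt
    have h1 : u ≤ cdf μ b := le_trans hy (hmono hlt.le)
    rw [hcdf] at h1
    linarith
  have hne : {y : ℝ | u ≤ cdf μ y}.Nonempty := ⟨t, by rw [mem_ofPred_eq, hcdf]; exact ht.le⟩
  refine ⟨fun h => csInf_le hbdd h, fun h => ?_⟩
  have hgt : ∀ y ∈ Ioi x, u ≤ cdf μ y := fun y hy => by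
    obtain ⟨z, hz, hzy⟩ := exists_lt_of_csInf_lt hne (lt_of_le_of_lt h hy)
    exact le_trans hz (hmono hzy.le)
  have hcont : Filter.Tendsto (cdf μ) (nhdsWithin x (Ioi x)) (nhds (cdf μ x)) := by
    rw [funext hcdf]
    exact ((ProbabilityTheory.cdf μ).right_continuous x).mono_left
      (nhdsWithin_mono _ Ioi_subset_Ici_self)
  exact ge_of_tendsto hcont (eventually_nhdsWithin_of_forall hgt)

lemma monotoneOn_quantile (μ : Measure ℝ) [IsProbabilityMeasure μ] :
    MonotoneOn (quantile μ) (Ioo 0 1) := fun _ ha _ hb hab =>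
  (le_cdf_iff_quantile_le μ ha _).1 (hab.trans ((le_cdf_iff_quantile_le μ hb _).2 le_rfl))

lemma aemeasurable_quantile (μ : Measure ℝ) [IsProbabilityMeasure μ] :
    AEMeasurable (quantile μ) (volume.restrict (Ioo 0 1)) :=
  aemeasurable_restrict_of_monotoneOn measurableSet_Ioo (monotoneOn_quantile μ)

/-- The quantile function pushes the uniform distribution on `(0, 1)` forward to `μ`. -/
lemma map_quantile (μ : Measure ℝ) [IsProbabilityMeasure μ] :
    (volume.restrict (Ioo (0 : ℝ) 1)).map (quantile μ) = μ := by
  have : IsFiniteMeasure (volume.restrict (Ioo (0 : ℝ) 1)) := ⟨by simp⟩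
  refine Measure.ext_of_Iic _ _ fun x => ?_
  have hle : cdf μ x ≤ 1 := measureReal_le_one
  rw [Measure.map_apply_of_aemeasurable (aemeasurable_quantile μ) measurableSet_Iic]
  have hset : volume.restrict (Ioo (0 : ℝ) 1) (quantile μ ⁻¹' Iic x)
      = volume.restrict (Ioo (0 : ℝ) 1) (Iic (cdf μ x)) := by
    refine measure_congr ?_
    filter_upwards [ae_restrict_mem measurableSet_Ioo] with u hu
    exact propext (le_cdf_iff_quantile_le μ hu x).symm
  rw [hset, restrict_Ioo_eq_restrict_Ioc, Measure.restrict_apply measurableSet_Iic,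
    inter_comm, Ioc_inter_Iic, min_eq_right hle, Real.volume_Ioc, sub_zero, cdf,
    ENNReal.ofReal_toReal (measure_ne_top _ _)]

lemma integrableOn_quantile (μ : Measure ℝ) [IsProbabilityMeasure μ]
    (hμ : Integrable (fun x : ℝ => x) μ) : IntegrableOn (quantile μ) (Ioo 0 1) := by
  rw [← map_quantile μ] at hμ
  exact (integrable_map_measure hμ.aestronglyMeasurable (aemeasurable_quantile μ)).1 hμ

lemma integral_comp_quantile (μ : Measure ℝ) [IsProbabilityMeasure μ] {f : ℝ → ℝ}
    (hf : Continuous f) : ∫ u in Ioo (0 : ℝ) 1, f (quantile μ u) = ∫ x, f x ∂μ := by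
  conv_rhs => rw [← map_quantile μ]
  exact (integral_map (aemeasurable_quantile μ) hf.aestronglyMeasurable).symm

/-- with `Q` the quantile function of `μ ∈ 𝒫₁(ℝ)` and `m = Q(1/2)` its
median, (i) `∫₀^{1/2}(Q(1−u)+Q(u)−2m)du = mean(μ) − m`,
(ii) `∫₀^{1/2}(Q(1−u)−Q(u))du = ∫|x − m| μ(dx)`, and consequently the integrated
quantile skewness equals Pearson-type skewness `(mean(μ) − m)/∫|x − m| μ(dx)` whenever
the denominator is nonzero. -/
theorem integrated_quantile_skewness
    (μ : Measure ℝ) [IsProbabilityMeasure μ] (hμ1 : Integrable (fun x : ℝ => x) μ) :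
    (∫ u in Set.Ioo (0:ℝ) (1/2),
        (quantile μ (1 - u) + quantile μ u - 2 * quantile μ (1/2)))
      = (∫ x, x ∂μ) - quantile μ (1/2) ∧
    (∫ u in Set.Ioo (0:ℝ) (1/2), (quantile μ (1 - u) - quantile μ u))
      = (∫ x, |x - quantile μ (1/2)| ∂μ) ∧
    ((∫ u in Set.Ioo (0:ℝ) (1/2), (quantile μ (1 - u) - quantile μ u)) ≠ 0 →
      (∫ u in Set.Ioo (0:ℝ) (1/2),
          (quantile μ (1 - u) + quantile μ u - 2 * quantile μ (1/2))) /
        (∫ u in Set.Ioo (0:ℝ) (1/2), (quantile μ (1 - u) - quantile μ u))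
        = ((∫ x, x ∂μ) - quantile μ (1/2)) / (∫ x, |x - quantile μ (1/2)| ∂μ)) := by
  set m := quantile μ (1 / 2)
  have hQ : IntervalIntegrable (quantile μ) volume 0 1 := by
    rw [intervalIntegrable_iff_integrableOn_Ioo_of_le zero_le_one]
    exact integrableOn_quantile μ hμ1
  have hL : IntervalIntegrable (quantile μ) volume 0 (1 / 2) :=
    hQ.mono_set (uIcc_subset_uIcc left_mem_uIcc (by norm_num [mem_uIcc]))
  have hR : IntervalIntegrable (quantile μ) volume (1 / 2) 1 :=
    hQ.mono_set (uIcc_subset_uIcc (by norm_num [mem_uIcc]) right_mem_uIcc)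
  have hR' : IntervalIntegrable (fun u => quantile μ (1 - u)) volume 0 (1 / 2) := by
    have := (hR.comp_sub_left 1).symm
    norm_num at this ⊢
    exact this
  have hrefl : ∫ u in (0 : ℝ)..1 / 2, quantile μ (1 - u) = ∫ u in (1 / 2 : ℝ)..1, quantile μ u := by
    rw [intervalIntegral.integral_comp_sub_left]
    norm_num
  have hIoo : ∀ (f : ℝ → ℝ) (b : ℝ), 0 ≤ b → ∫ u in Ioo 0 b, f u = ∫ u in (0 : ℝ)..b, f u :=
    fun f b hb => by rw [intervalIntegral.integral_of_le hb, integral_Ioc_eq_integral_Ioo]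
  have hmean : ∫ u in (0 : ℝ)..1, quantile μ u = ∫ x, x ∂μ := by
    rw [← hIoo _ _ zero_le_one]
    exact integral_comp_quantile μ continuous_id
  have habs : ∫ u in (0 : ℝ)..1, |quantile μ u - m| = ∫ x, |x - m| ∂μ := by
    rw [← hIoo _ _ zero_le_one]
    exact integral_comp_quantile μ (f := fun x => |x - m|) (by fun_prop)
  have hi : ∫ u in Ioo (0 : ℝ) (1 / 2), (quantile μ (1 - u) + quantile μ u - 2 * m)
      = (∫ x, x ∂μ) - m := by
    rw [hIoo _ _ (by norm_num), intervalIntegral.integral_sub (hR'.add hL) (by simp),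
      intervalIntegral.integral_add hR' hL, hrefl, ← hmean,
      ← intervalIntegral.integral_add_adjacent_intervals hL hR,
      intervalIntegral.integral_const, smul_eq_mul]
    ring
  have hii : ∫ u in Ioo (0 : ℝ) (1 / 2), (quantile μ (1 - u) - quantile μ u)
      = ∫ x, |x - m| ∂μ := by
    have hhalf : (1 / 2 : ℝ) ∈ Ioo (0 : ℝ) 1 := by norm_num
    have hleft : ∫ u in (0 : ℝ)..1 / 2, |quantile μ u - m|
        = ∫ u in (0 : ℝ)..1 / 2, (m - quantile μ u) := by
      rw [← hIoo _ _ (by norm_num), ← hIoo _ _ (by norm_num)]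
      refine setIntegral_congr_fun measurableSet_Ioo fun u hu => ?_
      have := monotoneOn_quantile μ ⟨hu.1, hu.2.trans hhalf.2⟩ hhalf hu.2.le
      exact (abs_of_nonpos (sub_nonpos.2 this)).trans (neg_sub _ _)
    have hright : ∫ u in (1 / 2 : ℝ)..1, |quantile μ u - m|
        = ∫ u in (1 / 2 : ℝ)..1, (quantile μ u - m) := by
      rw [intervalIntegral.integral_of_le hhalf.2.le, intervalIntegral.integral_of_le hhalf.2.le,
        integral_Ioc_eq_integral_Ioo, integral_Ioc_eq_integral_Ioo]
      refine setIntegral_congr_fun measurableSet_Ioo fun u hu => ?_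
      have := monotoneOn_quantile μ hhalf ⟨hhalf.1.trans hu.1, hu.2⟩ hu.1.le
      exact abs_of_nonneg (sub_nonneg.2 this)
    rw [hIoo _ _ (by norm_num), intervalIntegral.integral_sub hR' hL, hrefl, ← habs,
      ← intervalIntegral.integral_add_adjacent_intervals
        (hL.sub intervalIntegrable_const).abs (hR.sub intervalIntegrable_const).abs,
      hleft, hright, intervalIntegral.integral_sub intervalIntegrable_const hL,
      intervalIntegral.integral_sub hR intervalIntegrable_const,
      intervalIntegral.integral_const, intervalIntegral.integral_const, smul_eq_mul, smul_eq_mul]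
    ring
  exact ⟨hi, hii, fun _ => by rw [hi, hii]⟩
end
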